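/- For every 0 ≤ k ≤ N−1 and every 1 ≤ j ≤ k+1, the (1,j) entry of U_k equals the arrow sum: (U_k)_{1,j} = Σ {a}, where the sum runs over all sequences a ∈ {↙, ↘}^k containing exactly j−1 symbols ↘ (and k−j+1 symbols ↙). -/

import Mathlib

/-- The two arrow symbols `↙` (`sw`) and `↘` (`se`). -/
inductive Arrow : Type
  | sw  -- ↙ : multiply by `I_{1,t+r}`
  | se  -- ↘ : apply the shift `σ`
deriving DecidableEq

instance : Fintype Arrow where
  elems := {Arrow.sw, Arrow.se}
  complete := fun x => by cases x <;> simp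

/-- The ring `R = ℂ[I_{n,s} : n, s ∈ ℤ]`, realized as multivariate polynomials in the
variables `(n, s) : ℤ × ℤ` (the variable `(n, s)` is the indeterminate `I_{n,s}`). -/
abbrev TodaRing : Type := MvPolynomial (ℤ × ℤ) ℂ

/-- The shift homomorphism `σ : R → R`, `σ(I_{n,s}) = I_{n+1,s}`. -/
noncomputable def shiftσ : TodaRing →ₐ[ℂ] TodaRing :=
  MvPolynomial.rename (fun p => (p.1 + 1, p.2))

/-- Auxiliary bracket, recursing on the *last* element of the sequence: the argument list is
the sequence `(a_1, …, a_r)` in reverse order. -/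
noncomputable def bracketAux (t : ℤ) : List Arrow → TodaRing
  | [] => 1
  | Arrow.sw :: rest => MvPolynomial.X ((1 : ℤ), t + rest.length) * bracketAux t rest
  | Arrow.se :: rest => shiftσ (bracketAux t rest)

/-- The bracket `{(a_1, …, a_r)} ∈ R`, defined by `{()} = 1`,
`{(a_1, …, a_r, ↙)} = I_{1,t+r} · {(a_1, …, a_r)}` and
`{(a_1, …, a_r, ↘)} = σ({(a_1, …, a_r)})`. -/
noncomputable def bracket (t : ℤ) (a : List Arrow) : TodaRing :=
  bracketAux t a.reverse

/-- `u_j^{(k)}`: the sum of `{a}` over all sequences `a ∈ {↙,↘}^k` containing exactly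
`j - 1` symbols `↘`. -/
noncomputable def uSum (t : ℤ) (j k : ℕ) : TodaRing :=
  ∑ a ∈ Finset.univ.filter
      (fun a : Fin k → Arrow => (List.ofFn a).count Arrow.se = j - 1),
    bracket t (List.ofFn a)

/-- The matrix `R_s(y)` over `R[y]`: diagonal `I_{n,s}`, superdiagonal `1`, corner
`(N,1)`-entry `y`. -/
noncomputable def RmatP (N : ℕ) (s : ℤ) :
    Matrix (Fin N) (Fin N) (Polynomial TodaRing) :=
  fun i j =>
    if (i : ℕ) = (j : ℕ) then Polynomial.C (MvPolynomial.X ((((i : ℕ) : ℤ) + 1, s)))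
    else if (j : ℕ) = (i : ℕ) + 1 then 1
    else if (i : ℕ) = N - 1 ∧ (j : ℕ) = 0 then Polynomial.X
    else 0

/-- `U_k = R_{t+k-1}(y) ⋯ R_{t+1}(y) R_t(y)`, with `U_0` the identity matrix. -/
noncomputable def Umat (N : ℕ) (t : ℤ) : ℕ → Matrix (Fin N) (Fin N) (Polynomial TodaRing)
  | 0 => 1
  | k + 1 => RmatP N (t + k) * Umat N t k

theorem arrow_sum (f : Arrow → TodaRing) : ∑ x : Arrow, f x = f Arrow.sw + f Arrow.se := by
  have : (Finset.univ : Finset Arrow) = {Arrow.sw, Arrow.se} := rfl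
  rw [this, Finset.sum_pair (by decide)]

theorem uSum_zero (t : ℤ) (m : ℕ) : uSum t (m + 1) 0 = if m = 0 then 1 else 0 := by
  unfold uSum
  rw [Finset.sum_filter]
  simp [bracket, bracketAux, eq_comm]

theorem uSum_succ (t : ℤ) (m k : ℕ) :
    uSum t (m + 1) (k + 1) = MvPolynomial.X ((1 : ℤ), t + k) * uSum t (m + 1) k
      + (if m = 0 then 0 else shiftσ (uSum t m k)) := by
  unfold uSum
  rw [Finset.sum_filter, ← (Fin.snocEquiv (fun _ : Fin (k + 1) => Arrow)).sum_comp,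
    Fintype.sum_prod_type, arrow_sum]
  have hl : ∀ (x : Arrow) (a : Fin k → Arrow),
      List.ofFn ((Fin.snocEquiv (fun _ : Fin (k + 1) => Arrow)) (x, a)) = List.ofFn a ++ [x] := by
    intro x a
    rw [List.ofFn_succ']
    simp [Fin.snocEquiv]
  simp only [hl]
  congr 1
  · rw [Finset.sum_filter, Finset.mul_sum]
    refine Finset.sum_congr rfl fun a _ => ?_
    simp [bracket, bracketAux]
  · cases m with
    | zero => simp
    | succ m =>
      rw [Finset.sum_filter, if_neg (Nat.succ_ne_zero m), map_sum]
      refine Finset.sum_congr rfl fun a _ => ?_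
      simp only [bracket, List.reverse_append, List.reverse_singleton, List.singleton_append,
        bracketAux, List.count_append, List.count_singleton_self, Nat.add_sub_cancel,
        Nat.add_right_cancel_iff]
      split_ifs <;> simp

theorem shift_iter_X (i : ℕ) (s : ℤ) :
    (shiftσ^[i]) (MvPolynomial.X ((1 : ℤ), s)) = MvPolynomial.X ((i : ℤ) + 1, s) := by
  induction i with
  | zero => simp
  | succ i ih =>
    rw [Function.iterate_succ_apply', ih]
    simp [shiftσ]

theorem Umat_general (N : ℕ) (t : ℤ) (k : ℕ) : ∀ (i c : ℕ) (hi : i < N) (hc : c < N),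
    i + k ≤ N - 1 → Umat N t k ⟨i, hi⟩ ⟨c, hc⟩ =
      if i ≤ c then Polynomial.C ((shiftσ^[i]) (uSum t (c - i + 1) k)) else 0 := by
  induction k with
  | zero =>
    intro i c hi hc _
    rw [uSum_zero]
    simp only [Umat, Matrix.one_apply, Fin.mk.injEq]
    rcases lt_trichotomy i c with h | h | h
    · rw [if_neg (by omega), if_pos (by omega), if_neg (by omega), iterate_map_zero, map_zero]
    · rw [if_pos h, if_pos (by omega), if_pos (by omega), iterate_map_one, map_one]
    · rw [if_neg (by omega), if_neg (by omega)]
  | succ k ih =>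
    intro i c hi hc hik
    have hi' : i + 1 < N := by omega
    have hne : (⟨i, hi⟩ : Fin N) ≠ ⟨i + 1, hi'⟩ := by simp
    simp only [Umat, Matrix.mul_apply]
    rw [Finset.sum_eq_add (⟨i, hi⟩ : Fin N) ⟨i + 1, hi'⟩ hne]
    · rw [ih i c hi hc (by omega), ih (i + 1) c hi' hc (by omega), uSum_succ]
      simp only [RmatP, if_true, iterate_map_add, iterate_map_mul, shift_iter_X]
      rw [if_neg (by omega : ¬ i = i + 1), one_mul]
      rcases lt_trichotomy i c with h | h | h
      · rw [if_pos (by omega), if_pos (by omega), if_pos (by omega), if_neg (by omega),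
          ← Function.iterate_succ_apply, map_add, map_mul,
          show c - (i + 1) + 1 = c - i by omega]
      · rw [if_pos (by omega), if_neg (by omega), if_pos (by omega), if_pos (by omega),
          iterate_map_zero, map_add, map_mul, map_zero]
      · rw [if_neg (by omega), if_neg (by omega), if_neg (by omega)]
        simp
    · rintro ⟨l, hl⟩ _ ⟨h1, h2⟩
      simp only [ne_eq, Fin.mk.injEq] at h1 h2
      simp only [RmatP]
      rw [if_neg (by omega), if_neg (by omega), if_neg (by omega), zero_mul]
    · simp
    · simp

/-- for `0 ≤ k ≤ N-1` and `1 ≤ j ≤ k+1`, the `(1,j)` entry of `U_k` equals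
the arrow sum `u_j^{(k)}` (in particular it is a constant polynomial in `y`). -/
theorem Umat_entry_eq_uSum (N : ℕ) (hN : 2 ≤ N) (t : ℤ) (k : ℕ) (hk : k ≤ N - 1) :
    ∀ j : ℕ, ∀ _hj1 : 1 ≤ j, ∀ _hj2 : j ≤ k + 1,
      Umat N t k ⟨0, by omega⟩ ⟨j - 1, by omega⟩ = Polynomial.C (uSum t j k) := by
  intro j hj1 hj2
  rw [Umat_general N t k 0 (j - 1) _ _ (by omega), if_pos (Nat.zero_le _),
    show j - 1 - 0 + 1 = j by omega]
  rfl
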